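/- Let n ≥ 1 be an integer, b > 0 and d ∈ ℝ, with b not a positive integer and d not a nonnegative integer. If (d,b) lies above the staircase E_n, i.e. for every k ∈ {0,…,n−1} one has d ≥ k or b ≥ n−k, then the kernel T_{b,d} is totally positive of order n+1: for every m ∈ {1,…,n+1} and all reals 0 < x₁ < … < x_m and 0 < y₁ < … < y_m, det[T_{b,d}(x_i, y_j)]_{1≤i,j≤m} ≥ 0. -/

import Mathlib

/-- `f b ν z = Ψ(b, b+1-ν, z)`, the Tricomi confluent hypergeometric function,
given by its integral representation. -/
noncomputable def tricomiF (b ν z : ℝ) : ℝ :=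
  (1 / Real.Gamma b) * ∫ t in Set.Ioi (0:ℝ), Real.exp (-t * z) * t ^ (b - 1) * (1 + t) ^ (-ν)

/-- The kernel `T_{b,d}(x,y) = e^{-x/y} Ψ(b, b+1-d, x/y)`. -/
noncomputable def kernelT (b d x y : ℝ) : ℝ :=
  Real.exp (-(x / y)) * tricomiF b d (x / y)

section

open Matrix Set MeasureTheory

/-- The derivative of a determinant is the sum over rows of determinants with one row
differentiated. -/
theorem hasDerivAt_det_sum_updateRow {n : ℕ} {M M' : ℝ → Matrix (Fin n) (Fin n) ℝ} {x : ℝ}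
    (h : ∀ i j, HasDerivAt (fun t => M t i j) (M' x i j) x) :
    HasDerivAt (fun t => (M t).det) (∑ i, ((M x).updateRow i (M' x i)).det) x := by
  have h1 : HasDerivAt (fun t => ∑ σ : Equiv.Perm (Fin n),
      ((Equiv.Perm.sign σ : ℤ) : ℝ) * ∏ i, M t i (σ i))
      (∑ σ : Equiv.Perm (Fin n), ((Equiv.Perm.sign σ : ℤ) : ℝ) *
        ∑ i, (∏ j ∈ Finset.univ.erase i, M x j (σ j)) • M' x i (σ i)) x := by
    refine HasDerivAt.fun_sum fun σ _ => HasDerivAt.const_mul _ ?_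
    exact HasDerivAt.fun_finsetProd fun i _ => h i (σ i)
  have h2 : (fun t => (M t).det) = fun t => ∑ σ : Equiv.Perm (Fin n),
      ((Equiv.Perm.sign σ : ℤ) : ℝ) * ∏ i, M t i (σ i) := by
    funext t
    rw [← det_transpose, det_apply']
    rfl
  rw [h2]
  convert h1 using 1
  simp_rw [Finset.mul_sum]
  rw [Finset.sum_comm]
  refine Finset.sum_congr rfl fun i _ => ?_
  rw [← det_transpose, det_apply']
  refine Finset.sum_congr rfl fun σ _ => ?_
  congr 1
  rw [← Finset.mul_prod_erase _ _ (Finset.mem_univ i), smul_eq_mul, mul_comm]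
  congr 1
  · refine Finset.prod_congr rfl fun j hj => ?_
    simp [Matrix.updateRow_ne (Finset.ne_of_mem_erase hj)]
  · simp

/-- The Desnanot–Jacobi identity with an invertible inner block, for determinants of a kernel
sampled on lists of row and column indices. -/
theorem det_snoc_snoc_mul_det {ι κ : Type} {k : ℕ} (F : ι → κ → ℝ) (r : Fin k → ι)
    (c : Fin k → κ) (ρ₀ ρ₁ : ι) (γ₀ γ₁ : κ)
    (h : (of fun i j => F (r i) (c j)).det ≠ 0) :
    (of fun i j : Fin (k + 2) => F (Fin.snoc (α := fun _ => ι) (Fin.snoc (α := fun _ => ι) r ρ₀) ρ₁ i)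
        (Fin.snoc (α := fun _ => κ) (Fin.snoc (α := fun _ => κ) c γ₀) γ₁ j)).det *
      (of fun i j => F (r i) (c j)).det =
    (of fun i j : Fin (k + 1) => F (Fin.snoc (α := fun _ => ι) r ρ₀ i) (Fin.snoc (α := fun _ => κ) c γ₀ j)).det *
      (of fun i j : Fin (k + 1) => F (Fin.snoc (α := fun _ => ι) r ρ₁ i) (Fin.snoc (α := fun _ => κ) c γ₁ j)).det -
    (of fun i j : Fin (k + 1) => F (Fin.snoc (α := fun _ => ι) r ρ₀ i) (Fin.snoc (α := fun _ => κ) c γ₁ j)).det *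
      (of fun i j : Fin (k + 1) => F (Fin.snoc (α := fun _ => ι) r ρ₁ i) (Fin.snoc (α := fun _ => κ) c γ₀ j)).det := by
  set A : Matrix (Fin k) (Fin k) ℝ := of fun i j => F (r i) (c j) with hA
  have : Invertible A := A.invertibleOfIsUnitDet (Ne.isUnit h)
  have hb : ∀ ρ γ, (of fun i j : Fin (k + 1) => F (Fin.snoc (α := fun _ => ι) r ρ i)
      (Fin.snoc (α := fun _ => κ) c γ j)).det =
      A.det * (F ρ γ - ((of fun (_ : Fin 1) j => F ρ (c j)) * ⅟A *
        (of fun i (_ : Fin 1) => F (r i) γ)) 0 0) := by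
    intro ρ γ
    rw [← det_submatrix_equiv_self (finSumFinEquiv (m := k) (n := 1))]
    have : ((of fun i j : Fin (k + 1) => F (Fin.snoc (α := fun _ => ι) r ρ i)
      (Fin.snoc (α := fun _ => κ) c γ j)).submatrix finSumFinEquiv finSumFinEquiv) =
      fromBlocks A (of fun i (_ : Fin 1) => F (r i) γ) (of fun (_ : Fin 1) j => F ρ (c j))
        (of fun (_ _ : Fin 1) => F ρ γ) := by
      ext (i | i) (j | j)
      · exact congrArg₂ F (Fin.snoc_castSucc (α := fun _ => ι) ρ r i)
          (Fin.snoc_castSucc (α := fun _ => κ) γ c j)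
      · obtain rfl := Subsingleton.elim j 0
        exact congrArg₂ F (Fin.snoc_castSucc (α := fun _ => ι) ρ r i)
          (Fin.snoc_last (α := fun _ => κ) γ c)
      · obtain rfl := Subsingleton.elim i 0
        exact congrArg₂ F (Fin.snoc_last (α := fun _ => ι) ρ r)
          (Fin.snoc_castSucc (α := fun _ => κ) γ c j)
      · obtain rfl := Subsingleton.elim i 0
        obtain rfl := Subsingleton.elim j 0
        exact congrArg₂ F (Fin.snoc_last (α := fun _ => ι) ρ r)
          (Fin.snoc_last (α := fun _ => κ) γ c)
    rw [this, det_fromBlocks₁₁, det_fin_one]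
    rfl
  set ρ : Fin 2 → ι := ![ρ₀, ρ₁] with hρ
  set γ : Fin 2 → κ := ![γ₀, γ₁] with hγ
  have hr : ∀ {α : Type} (u : Fin k → α) (a b : α) (i : Fin k),
      Fin.snoc (α := fun _ => α) (Fin.snoc (α := fun _ => α) u a) b (Fin.castAdd 2 i) = u i := by
    intro α u a b i
    have : Fin.castAdd 2 i = i.castSucc.castSucc := rfl
    rw [this, Fin.snoc_castSucc, Fin.snoc_castSucc]
  have hr' : ∀ {α : Type} (u : Fin k → α) (a b : α) (i : Fin 2),
      Fin.snoc (α := fun _ => α) (Fin.snoc (α := fun _ => α) u a) b (Fin.natAdd k i) =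
        ![a, b] i := by
    intro α u a b i
    fin_cases i
    · have : Fin.natAdd k (0 : Fin 2) = (Fin.last k).castSucc := rfl
      simp only [Fin.zero_eta, this, Fin.snoc_castSucc, Fin.snoc_last]
      rfl
    · have : Fin.natAdd k (1 : Fin 2) = Fin.last (k + 1) := rfl
      simp only [Fin.mk_one, this, Fin.snoc_last]
      rfl
  have hbig : (of fun i j : Fin (k + 2) => F (Fin.snoc (α := fun _ => ι) (Fin.snoc (α := fun _ => ι) r ρ₀) ρ₁ i)
        (Fin.snoc (α := fun _ => κ) (Fin.snoc (α := fun _ => κ) c γ₀) γ₁ j)).det =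
      A.det * ((of fun a b : Fin 2 => F (ρ a) (γ b)) - (of fun (a : Fin 2) j => F (ρ a) (c j)) *
        ⅟A * (of fun i (b : Fin 2) => F (r i) (γ b))).det := by
    rw [← det_submatrix_equiv_self (finSumFinEquiv (m := k) (n := 2)), ← det_fromBlocks₁₁]
    congr 1
    ext (i | i) (j | j)
    · exact congrArg₂ F (hr r ρ₀ ρ₁ i) (hr c γ₀ γ₁ j)
    · exact congrArg₂ F (hr r ρ₀ ρ₁ i) (hr' c γ₀ γ₁ j)
    · exact congrArg₂ F (hr' r ρ₀ ρ₁ i) (hr c γ₀ γ₁ j)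
    · exact congrArg₂ F (hr' r ρ₀ ρ₁ i) (hr' c γ₀ γ₁ j)
  have hs : ∀ a b, ((of fun (a : Fin 2) j => F (ρ a) (c j)) *
        ⅟A * (of fun i (b : Fin 2) => F (r i) (γ b))) a b =
      ((of fun (_ : Fin 1) j => F (ρ a) (c j)) * ⅟A *
        (of fun i (_ : Fin 1) => F (r i) (γ b))) 0 0 := fun a b => by
    simp only [Matrix.mul_apply, of_apply]
  rw [hbig, hb, hb, hb, hb, det_fin_two]
  simp only [Matrix.sub_apply, hs]
  simp only [of_apply, hρ, hγ, Matrix.cons_val_zero, Matrix.cons_val_one]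
  ring

/-- Mean value theorem for determinants of increments. -/
theorem det_sub_pos_of_deriv {M : ℕ} {S : Set ℝ} (hS : S.OrdConnected) {h h' : Fin M → ℝ → ℝ}
    (hd : ∀ j, ∀ t ∈ S, HasDerivAt (h j) (h' j t) t)
    (hpos : ∀ ξ : Fin M → ℝ, StrictMono ξ → (∀ i, ξ i ∈ S) → 0 < (of fun i j => h' j (ξ i)).det)
    {x : Fin (M + 1) → ℝ} (hx : StrictMono x) (hxS : ∀ i, x i ∈ S) :
    0 < (of fun i j : Fin M => h j (x i.succ) - h j (x i.castSucc)).det := by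
  have key : ∀ s : Finset (Fin M), ∀ ξ : Fin M → ℝ,
      (∀ i, ξ i ∈ Ioo (x i.castSucc) (x i.succ)) →
      0 < (of fun i j : Fin M => if i ∈ s then h j (x i.succ) - h j (x i.castSucc)
        else h' j (ξ i)).det := by
    intro s
    induction s using Finset.induction_on with
    | empty =>
      intro ξ hξ
      simp only [Finset.notMem_empty, if_false]
      refine hpos ξ (fun i j hij => ?_) fun i =>
        hS.out (hxS i.castSucc) (hxS i.succ) ⟨(hξ i).1.le, (hξ i).2.le⟩
      exact (hξ i).2.trans_le ((hx.monotone (by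
        rw [Fin.le_def]; simpa using hij)).trans (hξ j).1.le)
    | insert a s ha ih =>
      intro ξ hξ
      set N : Matrix (Fin M) (Fin M) ℝ := of fun i j : Fin M =>
        if i ∈ s then h j (x i.succ) - h j (x i.castSucc) else h' j (ξ i) with hN
      have hlt : x a.castSucc < x a.succ := hx a.castSucc_lt_succ
      have hdet : ∀ v : Fin M → ℝ, (N.updateRow a v).det = ∑ j, v j * N.adjugate j a := by
        intro v
        rw [← cramer_transpose_apply, cramer_eq_adjugate_mulVec, mulVec, dotProduct]
        refine Finset.sum_congr rfl fun j _ => ?_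
        rw [← adjugate_transpose, transpose_apply, mul_comm]
      have hder : ∀ t ∈ S, HasDerivAt (fun t => (N.updateRow a fun j => h j t).det)
          ((N.updateRow a fun j => h' j t).det) t := by
        intro t ht
        simp only [hdet]
        exact HasDerivAt.fun_sum fun j _ => (hd j t ht).mul_const _
      have hsub : Icc (x a.castSucc) (x a.succ) ⊆ S := hS.out (hxS _) (hxS _)
      obtain ⟨c, hc, hcd⟩ := exists_hasDerivAt_eq_slope _ _ hlt
        (fun t ht => (hder t (hsub ht)).continuousAt.continuousWithinAt)
        (fun t ht => hder t (hsub (Ioo_subset_Icc_self ht)))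
      have h1 : 0 < (N.updateRow a fun j => h' j c).det := by
        have := ih (Function.update ξ a c) (fun i => by
          by_cases hi : i = a
          · subst hi; simpa using hc
          · simpa [hi] using hξ i)
        convert this using 2
        ext i j
        by_cases hi : i = a
        · subst hi; simp [ha]
        · simp [hi, hN]
      rw [hcd] at h1
      have h2 := (div_pos_iff_of_pos_right (sub_pos.2 hlt)).1 h1
      refine h2.trans_eq ?_
      rw [hdet, hdet, ← Finset.sum_sub_distrib]
      simp only [← sub_mul]
      rw [← hdet fun j => h j (x a.succ) - h j (x a.castSucc)]
      congr 1
      ext i j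
      by_cases hi : i = a
      · subst hi; simp
      · simp [hi, hN]
  have hmid : ∀ i : Fin M, ((x i.castSucc + x i.succ) / 2) ∈ Ioo (x i.castSucc) (x i.succ) := by
    intro i
    have : x i.castSucc < x i.succ := hx i.castSucc_lt_succ
    constructor <;> linarith
  simpa using key Finset.univ _ hmid

/-- The determinant of a matrix whose first column is constant one, in terms of row increments. -/
theorem det_cons_one_eq {M : ℕ} (g : Fin M → Fin (M + 1) → ℝ) :
    (of fun i j : Fin (M + 1) => (Fin.cons 1 (fun l => g l i) : Fin (M + 1) → ℝ) j).det =
      (of fun i j : Fin M => g j i.succ - g j i.castSucc).det := by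
  rw [det_eq_of_forall_row_eq_smul_add_pred (B := of fun i j : Fin (M + 1) =>
    (Fin.cons (Fin.cons 1 (fun _ => 0) : Fin (M + 1) → ℝ)
      (fun l => (Fin.cons 0 (fun m => g m l.succ - g m l.castSucc) : Fin (M + 1) → ℝ)) :
      Fin (M+1) → Fin (M + 1) → ℝ) i j + if i = 0 ∧ j ≠ 0 then
        (Fin.cons 0 (fun l => g l 0) : Fin (M + 1) → ℝ) j else 0) (fun _ => 1)]
  · rw [det_succ_column_zero, Fin.sum_univ_succ]
    simp only [of_apply, Fin.cons_zero, Fin.cons_succ]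
    simp
    congr 1
    ext i j
    simp
  · intro j
    refine Fin.cases ?_ (fun j => ?_) j <;> simp
  · intro i j
    refine Fin.cases ?_ (fun j => ?_) j <;> simp

/-- A system of functions with positive Wronskians on an interval has positive collocation
determinants there. -/
theorem det_pos_of_wronskian_pos {S : Set ℝ} (hS : S.OrdConnected) {N : ℕ} {F : ℕ → ℕ → ℝ → ℝ}
    (hF : ∀ i j, ∀ t ∈ S, HasDerivAt (F i j) (F (i + 1) j t) t)
    (hW : ∀ k ≤ N, ∀ t ∈ S, 0 < (of fun i j : Fin k => F i j t).det)
    {x : Fin N → ℝ} (hx : StrictMono x) (hxS : ∀ i, x i ∈ S) :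
    0 < (of fun i j : Fin N => F 0 j (x i)).det := by
  set sn : (k : ℕ) → ℕ → Fin (k + 1) → ℕ := fun k c =>
    Fin.snoc (α := fun _ => ℕ) (fun i : Fin k => (i : ℕ)) c with hsn
  have hsnk : ∀ k, sn k k = fun i : Fin (k + 1) => (i : ℕ) := by
    intro k
    funext i
    refine Fin.lastCases ?_ (fun i => ?_) i <;> simp [hsn]
  set A : ℕ → ℕ → ℝ → ℝ := fun k c t =>
    (of fun i j : Fin (k + 1) => F i (sn k c j) t).det with hA
  set B : ℕ → ℕ → ℝ → ℝ := fun k c t =>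
    (of fun i j : Fin (k + 1) => F (sn k (k + 1) i) (sn k c j) t).det with hB
  have hAk : ∀ k t, A k k t = (of fun i j : Fin (k + 1) => F i j t).det := by
    intro k t
    simp only [hA, hsnk]
  have hder : ∀ k c, ∀ t ∈ S, HasDerivAt (A k c) (B k c t) t := by
    intro k c t ht
    have := hasDerivAt_det_sum_updateRow (M := fun t => of fun i j : Fin (k + 1) =>
      F i (sn k c j) t) (M' := fun t => of fun i j : Fin (k + 1) => F (i + 1) (sn k c j) t)
      (x := t) (fun i j => hF _ _ t ht)
    refine this.congr_deriv ?_
    rw [Fin.sum_univ_castSucc, Finset.sum_eq_zero, zero_add]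
    · congr 1
      ext i j
      refine Fin.lastCases ?_ (fun i => ?_) i
      · simp [hsn]
      · rw [Matrix.updateRow_ne (Fin.castSucc_lt_last i).ne]
        simp [hsn]
    · intro i _
      refine det_zero_of_row_eq (i := i.castSucc) (j := i.succ) i.castSucc_lt_succ.ne ?_
      rw [Matrix.updateRow_self, Matrix.updateRow_ne i.castSucc_lt_succ.ne']
      ext j
      simp
  have hDJ : ∀ k ≤ N, ∀ c, ∀ t ∈ S, A (k + 1) c t * (of fun i j : Fin k => F i j t).det =
      A k k t * B k c t - A k c t * B k k t := by
    intro k hk c t ht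
    have := det_snoc_snoc_mul_det (fun i j => F i j t) (fun i : Fin k => (i : ℕ))
      (fun i : Fin k => (i : ℕ)) k (k + 1) k c (hW k hk t ht).ne'
    have e1 : (fun i : Fin (k + 1) => (i : ℕ)) = Fin.snoc (α := fun _ => ℕ)
      (fun i : Fin k => (i : ℕ)) k := (hsnk k).symm
    have e2 : (fun i : Fin (k + 2) => (i : ℕ)) = Fin.snoc (α := fun _ => ℕ)
      (fun i : Fin (k + 1) => (i : ℕ)) (k + 1) := (hsnk (k + 1)).symm
    rw [← e1, ← e2] at this
    simp only [hA, hB, hsn, ← e1]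
    exact this
  have main : ∀ M k, k + M ≤ N → ∀ y : Fin M → ℝ, StrictMono y → (∀ i, y i ∈ S) →
      0 < (of fun i j : Fin M => A k (k + j) (y i)).det := by
    intro M
    induction M with
    | zero => intro k _ y _ _; simp
    | succ M ih =>
      intro k hk y hy hyS
      have hApos : ∀ t ∈ S, 0 < A k k t := fun t ht => by
        rw [hAk]; exact hW (k + 1) (by omega) t ht
      have hdiv : (of fun i j : Fin (M + 1) => A k (k + j) (y i)).det =
          (∏ i, A k k (y i)) * (of fun i j : Fin (M + 1) =>
            (Fin.cons 1 (fun l : Fin M => A k (k + 1 + l) (y i) / A k k (y i)) :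
              Fin (M + 1) → ℝ) j).det := by
        rw [← det_mul_column]
        congr 1
        ext i j
        have := (hApos (y i) (hyS i)).ne'
        refine Fin.cases ?_ (fun j => ?_) j
        · simp
        · simp only [of_apply, Fin.cons_succ, Fin.val_succ]
          rw [mul_div_cancel₀ _ this, add_assoc, add_comm 1]
      rw [hdiv, det_cons_one_eq (fun (l : Fin M) i => A k (k + 1 + l) (y i) / A k k (y i))]
      refine mul_pos (Finset.prod_pos fun i _ => hApos _ (hyS i)) ?_
      refine det_sub_pos_of_deriv hS (h := fun j t => A k (k + 1 + j) t / A k k t)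
        (h' := fun j t => (of fun i j : Fin k => F i j t).det / A k k t ^ 2 *
          A (k + 1) (k + 1 + j) t) ?_ ?_ hy hyS
      · intro j t ht
        have := (hder k (k + 1 + j) t ht).div (hder k k t ht) (hApos t ht).ne'
        refine this.congr_deriv ?_
        have := hDJ k (by omega) (k + 1 + j) t ht
        rw [div_mul_eq_mul_div]
        congr 1
        linear_combination -this
      · intro ξ hξ hξS
        have := det_mul_column (fun i => (of fun a b : Fin k => F a b (ξ i)).det /
          A k k (ξ i) ^ 2) (of fun i j : Fin M => A (k + 1) (k + 1 + j) (ξ i))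
        simp only [of_apply] at this
        rw [this]
        exact mul_pos (Finset.prod_pos fun i _ => div_pos (hW k (by omega) _ (hξS i))
          (pow_pos (hApos _ (hξS i)) 2)) (ih (k + 1) (by omega) ξ hξ hξS)
  have := main N 0 (by omega) x hx hxS
  refine this.trans_eq (congrArg det ?_)
  ext i j
  simp only [hA, of_apply, zero_add]
  rw [det_fin_one]
  simp [hsn, Fin.snoc]

/-- The integrand of the (unnormalized) confluent hypergeometric integral. -/
noncomputable def confluentIntegrand (b d x w t : ℝ) : ℝ :=
  Real.exp (-(x * (w + t))) * (w + t) ^ (-d) * t ^ (b - 1)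

theorem confluentIntegrand_pos {b d x w t : ℝ} (hw : 0 < w) (ht : 0 < t) :
    0 < confluentIntegrand b d x w t := by
  unfold confluentIntegrand; positivity

theorem measurable_confluentIntegrand (b d x w : ℝ) : Measurable (confluentIntegrand b d x w) := by
  unfold confluentIntegrand; fun_prop

theorem exists_rpow_le_mul_exp (p : ℝ) {w ε : ℝ} (hw : 0 < w) (hε : 0 < ε) :
    ∃ C, ∀ y, w ≤ y → y ^ p ≤ C * Real.exp (ε * y) := by
  rcases le_or_gt p 0 with hp | hp
  · refine ⟨w ^ p, fun y hy => ?_⟩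
    have h1 : y ^ p ≤ w ^ p := Real.rpow_le_rpow_of_nonpos hw hy hp
    have h2 : 1 ≤ Real.exp (ε * y) := Real.one_le_exp (by nlinarith)
    have h3 : 0 < w ^ p := by positivity
    nlinarith
  · refine ⟨(p / ε) ^ p, fun y hy => ?_⟩
    have hy0 : 0 < y := hw.trans_le hy
    have h1 : ε * y / p ≤ Real.exp (ε * y / p) := by
      linarith [Real.add_one_le_exp (ε * y / p)]
    have h2 := Real.rpow_le_rpow (by positivity) h1 hp.le
    rw [← Real.exp_mul, div_mul_cancel₀ _ hp.ne'] at h2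
    calc y ^ p = (p / ε) ^ p * (ε * y / p) ^ p := by
          rw [← Real.mul_rpow (by positivity) (by positivity)]
          congr 1; field_simp
      _ ≤ _ := by gcongr

theorem integrableOn_confluentIntegrand {b x w : ℝ} (d : ℝ) (hb : 0 < b) (hx : 0 < x) (hw : 0 < w) :
    IntegrableOn (confluentIntegrand b d x w) (Ioi 0) := by
  obtain ⟨C, hC⟩ := exists_rpow_le_mul_exp (-d) hw (half_pos hx)
  have h := (integrableOn_rpow_mul_exp_neg_mul_rpow (p := 1) (s := b - 1) (b := x / 2)
    (by linarith) one_pos (half_pos hx)).const_mul (C * Real.exp (-(x / 2 * w)))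
  refine Integrable.mono' h (measurable_confluentIntegrand b d x w).aestronglyMeasurable ?_
  refine (ae_restrict_mem measurableSet_Ioi).mono fun t ht => ?_
  have ht : 0 < t := ht
  rw [Real.norm_of_nonneg (confluentIntegrand_pos hw ht).le]
  have h1 := hC (w + t) (by linarith)
  have h2 : Real.exp (-(x * (w + t))) * Real.exp (x / 2 * (w + t)) =
      Real.exp (-(x / 2 * w)) * Real.exp (-(x / 2) * t ^ (1 : ℝ)) := by
    rw [← Real.exp_add, ← Real.exp_add, Real.rpow_one]; congr 1; ring
  unfold confluentIntegrand
  calc _ ≤ Real.exp (-(x * (w + t))) * (C * Real.exp (x / 2 * (w + t))) * t ^ (b - 1) := by gcongr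
    _ = _ := by linear_combination C * t ^ (b - 1) * h2

/-- The integral of `confluentIntegrand` over the positive half-line. -/
noncomputable def confluentIntegral (b d x w : ℝ) : ℝ :=
  ∫ t in Ioi (0 : ℝ), confluentIntegrand b d x w t

theorem confluentIntegral_sub_one_right {b d x w : ℝ} (hb : 0 < b) (hx : 0 < x) (hw : 0 < w) :
    confluentIntegral b (d - 1) x w = w * confluentIntegral b d x w +
      confluentIntegral (b + 1) d x w := by
  unfold confluentIntegral
  rw [← integral_const_mul, ← integral_add ((integrableOn_confluentIntegrand d hb hx hw).const_mul w)
    (integrableOn_confluentIntegrand d (by linarith) hx hw)]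
  refine setIntegral_congr_fun measurableSet_Ioi fun t ht => ?_
  have ht : 0 < t := ht
  simp only [confluentIntegrand]
  rw [show -(d - 1) = -d + 1 by ring, Real.rpow_add_one (by positivity),
    show b + 1 - 1 = b - 1 + 1 by ring, Real.rpow_add_one (by positivity)]
  ring

theorem mul_confluentIntegral {b d x w : ℝ} (hb : 0 < b) (hx : 0 < x) (hw : 0 < w) :
    b * confluentIntegral b d x w = x * confluentIntegral (b + 1) d x w +
      d * confluentIntegral (b + 1) (d + 1) x w := by
  have hi := integrableOn_confluentIntegrand d hb hx hw
  have hi1 := integrableOn_confluentIntegrand (b := b + 1) d (by linarith) hx hw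
  have hi2 := integrableOn_confluentIntegrand (b := b + 1) (d + 1) (by linarith) hx hw
  have hi' : IntegrableOn (fun t => b * confluentIntegrand b d x w t -
      (x * confluentIntegrand (b + 1) d x w t + d * confluentIntegrand (b + 1) (d + 1) x w t))
      (Ioi 0) := (hi.const_mul b).sub ((hi1.const_mul x).add (hi2.const_mul d))
  have hder : ∀ t ∈ Ioi (0 : ℝ), HasDerivAt (confluentIntegrand (b + 1) d x w)
      (b * confluentIntegrand b d x w t -
      (x * confluentIntegrand (b + 1) d x w t + d * confluentIntegrand (b + 1) (d + 1) x w t)) t := by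
    intro t ht
    have ht : 0 < t := ht
    have hl : HasDerivAt (fun t => w + t) 1 t := (hasDerivAt_id t).const_add w
    have h1 := (hl.const_mul x).neg.exp
    have h2 := hl.rpow_const (p := -d) (Or.inl (by positivity))
    have h3 := (hasDerivAt_id t).rpow_const (p := b + 1 - 1) (Or.inl ht.ne')
    refine ((h1.mul h2).mul h3).congr_deriv ?_
    simp only [confluentIntegrand, id, Pi.mul_apply, Pi.neg_apply]
    rw [show -(d + 1) = -d - 1 by ring, show b + 1 - 1 - 1 = b - 1 by ring]
    ring
  have hint := integral_Ioi_of_hasDerivAt_of_tendsto (a := 0) (m := 0)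
    (f := confluentIntegrand (b + 1) d x w) ?_ hder hi' ?_
  · have hs : IntegrableOn (fun t => x * confluentIntegrand (b + 1) d x w t +
        d * confluentIntegrand (b + 1) (d + 1) x w t) (Ioi 0) :=
      (hi1.const_mul x).add (hi2.const_mul d)
    rw [integral_sub (hi.const_mul b) hs,
      integral_add (hi1.const_mul x) (hi2.const_mul d), integral_const_mul, integral_const_mul,
      integral_const_mul] at hint
    have h0 : confluentIntegrand (b + 1) d x w 0 = 0 := by
      simp [confluentIntegrand, Real.zero_rpow hb.ne']
    rw [h0] at hint
    unfold confluentIntegral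
    linarith
  · refine ContinuousAt.continuousWithinAt ?_
    unfold confluentIntegrand
    refine ((by fun_prop : Continuous fun t => Real.exp (-(x * (w + t)))).continuousAt.mul ?_).mul ?_
    · refine ContinuousAt.rpow_const (by fun_prop) (Or.inl (by simpa using hw.ne'))
    · exact Real.continuousAt_rpow_const _ _ (Or.inr (by linarith))
  · exact tendsto_zero_of_hasDerivAt_of_integrableOn_Ioi hder hi' hi1

theorem hasDerivAt_confluentIntegral {b d x w : ℝ} (hb : 0 < b) (hx : 0 < x) (hw : 0 < w) :
    HasDerivAt (fun x => confluentIntegral b d x w) (-confluentIntegral b (d - 1) x w) x := by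
  unfold confluentIntegral
  rw [← integral_neg]
  refine (hasDerivAt_integral_of_dominated_loc_of_deriv_le
    (F := fun x t => confluentIntegrand b d x w t)
    (F' := fun x t => -confluentIntegrand b (d - 1) x w t) (x₀ := x)
    (bound := confluentIntegrand b (d - 1) (x / 2) w)
    (s := Ioi (x / 2)) (Ioi_mem_nhds (half_lt_self hx)) ?_ (integrableOn_confluentIntegrand d hb hx hw)
    (measurable_confluentIntegrand b (d - 1) x w).neg.aestronglyMeasurable ?_
    (integrableOn_confluentIntegrand (d - 1) hb (half_pos hx) hw) ?_).2
  · exact Filter.Eventually.of_forall fun y =>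
      (measurable_confluentIntegrand b d y w).aestronglyMeasurable
  · refine (ae_restrict_mem measurableSet_Ioi).mono fun t ht y hy => ?_
    have ht : 0 < t := ht
    have hy : x / 2 < y := hy
    rw [norm_neg, Real.norm_of_nonneg (confluentIntegrand_pos hw ht).le]
    unfold confluentIntegrand
    gcongr
  · refine (ae_restrict_mem measurableSet_Ioi).mono fun t ht y hy => ?_
    have ht : 0 < t := ht
    have h1 := (((hasDerivAt_id y).mul_const (w + t)).neg.exp.mul_const ((w + t) ^ (-d))).mul_const
      (t ^ (b - 1))
    refine h1.congr_deriv ?_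
    simp only [confluentIntegrand, id, Pi.neg_apply]
    rw [show -(d - 1) = -d + 1 by ring, Real.rpow_add_one (by positivity)]
    ring

theorem confluentIntegral_eq_rpow_mul {b d x w : ℝ} (hw : 0 < w) :
    confluentIntegral b d x w = w ^ (b - d) * confluentIntegral b d (x * w) 1 := by
  unfold confluentIntegral
  have h := integral_comp_mul_left_Ioi (confluentIntegrand b d x w) 0 hw
  rw [mul_zero, smul_eq_mul, eq_inv_mul_iff_mul_eq₀ hw.ne'] at h
  rw [← h, ← integral_const_mul, ← integral_const_mul]
  refine setIntegral_congr_fun measurableSet_Ioi fun t ht => ?_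
  have ht : 0 < t := ht
  simp only [confluentIntegrand]
  rw [show w + w * t = w * (1 + t) by ring, Real.mul_rpow hw.le (by positivity),
    Real.mul_rpow hw.le ht.le, show b - d = 1 + (-d) + (b - 1) by ring,
    Real.rpow_add hw, Real.rpow_add hw, Real.rpow_one, mul_assoc x w]
  ring

theorem hasDerivAt_confluentIntegral_right {b d x w : ℝ} (hb : 0 < b) (hx : 0 < x) (hw : 0 < w) :
    HasDerivAt (fun w => confluentIntegral b d x w)
      (w⁻¹ * ((b - d) * confluentIntegral b d x w - x * confluentIntegral b (d - 1) x w)) w := by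
  have h1 := (hasDerivAt_id w).rpow_const (p := b - d) (Or.inl hw.ne')
  have h2 := (hasDerivAt_confluentIntegral (d := d) hb (mul_pos hx hw) one_pos).comp w
    ((hasDerivAt_id w).const_mul x)
  refine ((h1.mul h2).congr_of_eventuallyEq ?_).congr_deriv ?_
  · filter_upwards [Ioi_mem_nhds hw] with v hv
    exact confluentIntegral_eq_rpow_mul hv
  · rw [confluentIntegral_eq_rpow_mul (d := d) hw, confluentIntegral_eq_rpow_mul (d := d - 1) hw,
      show b - (d - 1) = b - d + 1 by ring, Real.rpow_add_one hw.ne']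
    simp only [id, Function.comp]
    rw [Real.rpow_sub_one hw.ne']
    field_simp
    ring

theorem gamma_mul_confluentIntegral {b d x w : ℝ} (hb : 0 < b) (hd : 0 < d) (hx : 0 < x)
    (hw : 0 < w) :
    Real.Gamma d * confluentIntegral b d x w = Real.Gamma b * confluentIntegral d b w x := by
  set K : ℝ × ℝ → ℝ := fun p =>
    Real.exp (-((x + p.2) * (w + p.1))) * p.1 ^ (b - 1) * p.2 ^ (d - 1) with hK
  have e1 : ∀ t s : ℝ, K (t, s) = Real.exp (-(x * (w + t))) * t ^ (b - 1) *
      (s ^ (d - 1) * Real.exp (-((w + t) * s))) := fun t s => by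
    simp only [hK]
    rw [show -((x + s) * (w + t)) = -(x * (w + t)) + -((w + t) * s) by ring, Real.exp_add]
    ring
  have e2 : ∀ t s : ℝ, K (t, s) = Real.exp (-(w * (x + s))) * s ^ (d - 1) *
      (t ^ (b - 1) * Real.exp (-((x + s) * t))) := fun t s => by
    simp only [hK]
    rw [show -((x + s) * (w + t)) = -(w * (x + s)) + -((x + s) * t) by ring, Real.exp_add]
    ring
  have i1 : ∀ t ∈ Ioi (0 : ℝ), ∫ s in Ioi (0 : ℝ), K (t, s) =
      Real.Gamma d * confluentIntegrand b d x w t := fun t ht => by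
    have ht : 0 < t := ht
    simp_rw [e1]
    rw [integral_const_mul, Real.integral_rpow_mul_exp_neg_mul_Ioi hd (by positivity),
      confluentIntegrand, one_div, Real.inv_rpow (by positivity), Real.rpow_neg (by positivity)]
    ring
  have i2 : ∀ s ∈ Ioi (0 : ℝ), ∫ t in Ioi (0 : ℝ), K (t, s) =
      Real.Gamma b * confluentIntegrand d b w x s := fun s hs => by
    have hs : 0 < s := hs
    simp_rw [e2]
    rw [integral_const_mul, Real.integral_rpow_mul_exp_neg_mul_Ioi hb (by positivity),
      confluentIntegrand, one_div, Real.inv_rpow (by positivity), Real.rpow_neg (by positivity)]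
    ring
  have hint : Integrable (Function.uncurry fun t s => K (t, s))
      ((volume.restrict (Ioi (0 : ℝ))).prod (volume.restrict (Ioi (0 : ℝ)))) := by
    refine (integrable_prod_iff ?_).2 ⟨?_, ?_⟩
    · refine Measurable.aestronglyMeasurable ?_
      simp only [hK]
      fun_prop
    · refine (ae_restrict_mem measurableSet_Ioi).mono fun t ht => ?_
      have ht : 0 < t := ht
      have h := (integrableOn_rpow_mul_exp_neg_mul_rpow (p := 1) (s := d - 1) (b := w + t)
        (by linarith) one_pos (by positivity)).const_mul (Real.exp (-(x * (w + t))) * t ^ (b - 1))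
      refine h.congr (Filter.Eventually.of_forall fun s => ?_)
      simp only [Function.uncurry, e1, Real.rpow_one, neg_mul]
    · refine Integrable.congr ((integrableOn_confluentIntegrand d hb hx hw).const_mul
        (Real.Gamma d)) ?_
      refine (ae_restrict_mem measurableSet_Ioi).mono fun t ht => ?_
      simp only [Function.uncurry]
      rw [← i1 t ht]
      refine setIntegral_congr_fun measurableSet_Ioi fun s hs => ?_
      have ht : 0 < t := ht
      have hs : 0 < s := hs
      refine (Real.norm_of_nonneg ?_).symm
      simp only [hK]
      positivity
  have hF := integral_integral_swap hint
  rw [setIntegral_congr_fun measurableSet_Ioi i1, setIntegral_congr_fun measurableSet_Ioi i2,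
    integral_const_mul, integral_const_mul] at hF
  exact hF

/-- The `m`-fold downward continuation in `b` of the normalized confluent integral. -/
noncomputable def tricomiVAux : ℕ → ℝ → ℝ → ℝ → ℝ → ℝ
  | 0, b, d, x, w => (Real.Gamma b)⁻¹ * confluentIntegral b d x w
  | m + 1, b, d, x, w => x * tricomiVAux m (b + 1) d x w + d * tricomiVAux m (b + 1) (d + 1) x w

/-- The function `w ^ (b - d) * exp (-x * w) * Ψ(b, b + 1 - d, x * w)`, for all real `b`. -/
noncomputable def tricomiV (b d x w : ℝ) : ℝ := tricomiVAux (⌊-b⌋ + 1).toNat b d x w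

theorem tricomiV_of_pos {b : ℝ} (hb : 0 < b) (d x w : ℝ) :
    tricomiV b d x w = (Real.Gamma b)⁻¹ * confluentIntegral b d x w := by
  have h : ⌊-b⌋ < 0 := Int.floor_lt.2 (by simpa using hb)
  rw [tricomiV, Int.toNat_of_nonpos (by omega), tricomiVAux]

theorem forall_real_of_sub_one {P : ℝ → Prop} (h0 : ∀ b, 0 < b → P b)
    (h1 : ∀ b, b ≤ 1 → P b → P (b - 1)) (b : ℝ) : P b := by
  have key : ∀ n : ℕ, ∀ b : ℝ, -(n : ℝ) < b → P b := by
    intro n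
    induction n with
    | zero => intro b hb; exact h0 b (by simpa using hb)
    | succ n ih =>
      intro b hb
      rcases lt_or_ge 0 b with h | h
      · exact h0 b h
      · push_cast at hb
        simpa using h1 (b + 1) (by linarith) (ih (b + 1) (by linarith))
  obtain ⟨n, hn⟩ := exists_nat_gt (-b)
  exact key n b (by linarith)

theorem tricomiV_sub_one_left (b d : ℝ) {x w : ℝ} (hx : 0 < x) (hw : 0 < w) :
    tricomiV (b - 1) d x w = x * tricomiV b d x w + d * tricomiV b (d + 1) x w := by
  rcases le_or_gt b 1 with hb | hb
  · have h : -1 ≤ ⌊-b⌋ := Int.le_floor.2 (by push_cast; linarith)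
    have h2 : (⌊-(b - 1)⌋ + 1).toNat = (⌊-b⌋ + 1).toNat + 1 := by
      rw [show -(b - 1) = -b + 1 by ring, Int.floor_add_one]
      omega
    rw [tricomiV, h2, tricomiVAux, sub_add_cancel, tricomiV, tricomiV]
  · rw [tricomiV_of_pos (by linarith), tricomiV_of_pos (by linarith), tricomiV_of_pos (by linarith)]
    have h := mul_confluentIntegral (b := b - 1) (d := d) (by linarith) hx hw
    have hG := Real.Gamma_add_one (s := b - 1) (by linarith)
    have hG0 : Real.Gamma (b - 1) ≠ 0 := (Real.Gamma_pos_of_pos (by linarith)).ne'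
    have hb1 : b - 1 ≠ 0 := by linarith
    rw [sub_add_cancel] at h hG
    rw [hG]
    field_simp
    linear_combination h

theorem tricomiV_sub_one_right (b d : ℝ) {x w : ℝ} (hx : 0 < x) (hw : 0 < w) :
    tricomiV b (d - 1) x w = w * tricomiV b d x w + b * tricomiV (b + 1) d x w := by
  revert d
  refine forall_real_of_sub_one (P := fun b => ∀ d, tricomiV b (d - 1) x w =
    w * tricomiV b d x w + b * tricomiV (b + 1) d x w) ?_ ?_ b
  · intro b hb d
    rw [tricomiV_of_pos hb, tricomiV_of_pos hb, tricomiV_of_pos (by linarith),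
      confluentIntegral_sub_one_right hb hx hw, Real.Gamma_add_one hb.ne']
    have hG0 : Real.Gamma b ≠ 0 := (Real.Gamma_pos_of_pos hb).ne'
    field_simp
  · intro b _ ih d
    have h1 := ih d
    have h2 := ih (d + 1)
    have h3 := tricomiV_sub_one_left b (d - 1) hx hw
    have h4 := tricomiV_sub_one_left b d hx hw
    have h5 := tricomiV_sub_one_left (b + 1) d hx hw
    simp only [sub_add_cancel, add_sub_cancel_right] at *
    linear_combination h3 + x * h1 + d * h2 - w * h4 - b * h5

theorem hasDerivAt_tricomiV (b d : ℝ) {x w : ℝ} (hx : 0 < x) (hw : 0 < w) :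
    HasDerivAt (fun x => tricomiV b d x w) (-tricomiV b (d - 1) x w) x := by
  revert d
  refine forall_real_of_sub_one (P := fun b => ∀ d,
    HasDerivAt (fun x => tricomiV b d x w) (-tricomiV b (d - 1) x w) x) ?_ ?_ b
  · intro b hb d
    simp only [tricomiV_of_pos hb]
    exact ((hasDerivAt_confluentIntegral hb hx hw).const_mul _).congr_deriv (by ring)
  · intro b _ ih d
    refine ((((hasDerivAt_id x).mul (ih d)).add ((ih (d + 1)).const_mul d)).congr_of_eventuallyEq
      ?_).congr_deriv ?_
    · filter_upwards [Ioi_mem_nhds hx] with y hy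
      exact tricomiV_sub_one_left b d hy hw
    · rw [tricomiV_sub_one_left b (d - 1) hx hw]
      simp only [sub_add_cancel, add_sub_cancel_right, id]
      ring

theorem hasDerivAt_tricomiV_right (b d : ℝ) {x w : ℝ} (hx : 0 < x) (hw : 0 < w) :
    HasDerivAt (fun w => tricomiV b d x w) (-tricomiV (b - 1) d x w) w := by
  revert d
  refine forall_real_of_sub_one (P := fun b => ∀ d,
    HasDerivAt (fun w => tricomiV b d x w) (-tricomiV (b - 1) d x w) w) ?_ ?_ b
  · intro b hb d
    have h1 := tricomiV_sub_one_right b d hx hw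
    have h2 := tricomiV_sub_one_right b (d + 1) hx hw
    have h3 := tricomiV_sub_one_left (b + 1) d hx hw
    have h4 := tricomiV_sub_one_left b d hx hw
    have h := (hasDerivAt_confluentIntegral_right (d := d) hb hx hw).const_mul (Real.Gamma b)⁻¹
    have h5 : tricomiV (b - 1) d x w =
        w⁻¹ * (x * tricomiV b (d - 1) x w - (b - d) * tricomiV b d x w) := by
      rw [eq_inv_mul_iff_mul_eq₀ hw.ne']
      simp only [add_sub_cancel_right] at *
      linear_combination w * h4 - x * h1 - d * h2 + b * h3
    rw [h5]
    simp only [tricomiV_of_pos hb]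
    exact h.congr_deriv (by ring)
  · intro b _ ih d
    refine ((((ih d).const_mul x).add ((ih (d + 1)).const_mul d)).congr_of_eventuallyEq
      ?_).congr_deriv ?_
    · filter_upwards [Ioi_mem_nhds hw] with y hy
      exact tricomiV_sub_one_left b d hx hy
    · rw [tricomiV_sub_one_left (b - 1) d hx hw]
      ring

theorem tricomiV_comm (b : ℝ) {d x w : ℝ} (hd : 0 < d) (hx : 0 < x) (hw : 0 < w) :
    tricomiV b d x w = tricomiV d b w x := by
  revert d
  refine forall_real_of_sub_one (P := fun b => ∀ {d}, 0 < d →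
    tricomiV b d x w = tricomiV d b w x) ?_ ?_ b
  · intro b hb d hd
    rw [tricomiV_of_pos hb, tricomiV_of_pos hd]
    have h := gamma_mul_confluentIntegral hb hd hx hw
    have hG0 : Real.Gamma b ≠ 0 := (Real.Gamma_pos_of_pos hb).ne'
    have hG1 : Real.Gamma d ≠ 0 := (Real.Gamma_pos_of_pos hd).ne'
    field_simp
    linear_combination h
  · intro b _ ih d hd
    rw [tricomiV_sub_one_left b d hx hw, tricomiV_sub_one_right d b hw hx, ih hd,
      ih (by linarith : 0 < d + 1)]

theorem sign_revPerm (N : ℕ) :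
    Equiv.Perm.sign (Fin.revPerm : Equiv.Perm (Fin N)) = ∏ j : Fin N, (-1) ^ (j : ℕ) := by
  rw [Equiv.Perm.sign_eq_prod_prod_Iio]
  refine Finset.prod_congr rfl fun j _ => ?_
  rw [Finset.prod_congr rfl (g := fun _ => -1), Finset.prod_const, Fin.card_Iio]
  intro i hi
  have : i < j := Finset.mem_Iio.1 hi
  simp [this.le]

theorem det_toeplitz_mul_det {M : ℕ} (f : ℤ → ℝ) (h : (of fun i j : Fin M => f (i - j)).det ≠ 0) :
    (of fun i j : Fin (M + 2) => f (i - j)).det * (of fun i j : Fin M => f (i - j)).det =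
      (of fun i j : Fin (M + 1) => f (i - j)).det ^ 2 -
      (of fun i j : Fin (M + 1) => f (-1 + i - j)).det *
        (of fun i j : Fin (M + 1) => f (1 + i - j)).det := by
  have key := det_snoc_snoc_mul_det (fun i j : ℤ => f (i - j)) (fun i : Fin M => (i : ℤ))
    (fun i : Fin M => (i : ℤ)) (-1) M (-1) M h
  set σ : Equiv.Perm (Fin (M + 1)) := finRotate (M + 1) with hσ
  set τ : Equiv.Perm (Fin (M + 2)) :=
    (finSumFinEquiv (m := M + 1) (n := 1)).permCongr (Equiv.sumCongr σ (Equiv.refl _)) with hτ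
  have e0 : Fin.snoc (α := fun _ => ℤ) (fun i : Fin M => (i : ℤ)) (-1) =
      fun i => ((σ i : ℕ) : ℤ) - 1 := by
    funext i
    refine Fin.lastCases ?_ (fun i => ?_) i
    · simp [hσ]
    · simp [hσ]
  have e1 : Fin.snoc (α := fun _ => ℤ) (fun i : Fin M => (i : ℤ)) M =
      fun i : Fin (M + 1) => ((i : ℕ) : ℤ) := by
    funext i
    refine Fin.lastCases ?_ (fun i => ?_) i <;> simp
  have e2 : Fin.snoc (α := fun _ => ℤ) (fun i => ((σ i : ℕ) : ℤ) - 1) M =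
      fun i => ((τ i : ℕ) : ℤ) - 1 := by
    funext i
    refine Fin.lastCases ?_ (fun i => ?_) i
    · have : τ (Fin.last (M + 1)) = Fin.last (M + 1) := by
        have h1 : finSumFinEquiv (m := M + 1) (n := 1) (Sum.inr 0) = Fin.last (M + 1) := by
          ext; simp
        rw [hτ, Equiv.permCongr_apply, ← h1, Equiv.symm_apply_apply]
        simp
      rw [this]
      simp
    · have : τ i.castSucc = (σ i).castSucc := by
        have h1 : ∀ i, finSumFinEquiv (m := M + 1) (n := 1) (Sum.inl i) = i.castSucc := by
          intro i; ext; simp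
        rw [hτ, Equiv.permCongr_apply, ← h1, Equiv.symm_apply_apply]
        simp [← h1]
      rw [this]
      simp
  rw [e0, e1, e2] at key
  have d1 := det_submatrix_equiv_self τ (of fun i j : Fin (M + 2) => f (i - j))
  have d2 := det_submatrix_equiv_self σ (of fun i j : Fin (M + 1) => f (i - j))
  have d3 := det_permute σ (of fun i j : Fin (M + 1) => f (-1 + i - j))
  have d4 := det_permute' σ (of fun i j : Fin (M + 1) => f (1 + i - j))
  have d5 : ((Equiv.Perm.sign σ : ℤ) : ℝ) * ((Equiv.Perm.sign σ : ℤ) : ℝ) = 1 := by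
    rcases Int.units_eq_one_or (Equiv.Perm.sign σ) with h | h <;> simp [h]
  have q1 : (of fun i j : Fin (M + 2) => f (((τ i : ℕ) : ℤ) - 1 - (((τ j : ℕ) : ℤ) - 1))) =
      (of fun i j : Fin (M + 2) => f (i - j)).submatrix τ τ := by
    ext i j; simp
  have q2 : (of fun i j : Fin (M + 1) => f (((σ i : ℕ) : ℤ) - 1 - (((σ j : ℕ) : ℤ) - 1))) =
      (of fun i j : Fin (M + 1) => f (i - j)).submatrix σ σ := by
    ext i j; simp
  have q3 : (of fun i j : Fin (M + 1) => f (((σ i : ℕ) : ℤ) - 1 - j)) =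
      (of fun i j : Fin (M + 1) => f (-1 + i - j)).submatrix σ id := by
    ext i j; exact congrArg f (by simp only [id]; ring)
  have q4 : (of fun i j : Fin (M + 1) => f (i - (((σ j : ℕ) : ℤ) - 1))) =
      (of fun i j : Fin (M + 1) => f (1 + i - j)).submatrix id σ := by
    ext i j; exact congrArg f (by simp only [id]; ring)
  rw [q1, q2, q3, q4, d1, d2, d3, d4] at key
  rw [key]
  linear_combination (-(of fun i j : Fin (M + 1) => f (-1 + i - j)).det *
        (of fun i j : Fin (M + 1) => f (1 + i - j)).det) * d5

theorem det_confluentIntegral_pos {N : ℕ} {b x w : ℝ} (d : ℝ) (hb : 0 < b) (hx : 0 < x)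
    (hw : 0 < w) :
    0 < (of fun i j : Fin N => confluentIntegral (b + i + j) d x w).det := by
  have hpow : ∀ (i j : Fin N) (t : ℝ), 0 < t → confluentIntegrand (b + i + j) d x w t =
      t ^ (i : ℕ) * t ^ (j : ℕ) * confluentIntegrand b d x w t := by
    intro i j t ht
    simp only [confluentIntegrand]
    rw [show b + i + j - 1 = b - 1 + (i : ℕ) + (j : ℕ) by ring, Real.rpow_add_natCast ht.ne',
      Real.rpow_add_natCast ht.ne']
    ring
  refine PosDef.det_pos (PosDef.of_dotProduct_mulVec_pos ?_ ?_)
  · ext i j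
    simp only [conjTranspose_apply, of_apply, star_trivial]
    rw [add_right_comm]
  · intro v hv
    set p : Polynomial ℝ := ∑ i : Fin N, Polynomial.monomial (i : ℕ) (v i) with hp
    have hpe : ∀ t, p.eval t = ∑ i, v i * t ^ (i : ℕ) := by
      intro t
      simp [hp, Polynomial.eval_finsetSum]
    have hp0 : p ≠ 0 := by
      intro h
      refine hv (funext fun i => ?_)
      have := congrArg (fun q => Polynomial.coeff q i) h
      simpa [hp, Polynomial.finsetSum_coeff, Polynomial.coeff_monomial, Fin.val_inj] using this
    have hint : ∀ i j : Fin N, IntegrableOn (fun t => v i * v j *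
        confluentIntegrand (b + i + j) d x w t) (Ioi 0) := fun i j =>
      (integrableOn_confluentIntegrand d (by positivity) hx hw).const_mul _
    have hsum : IntegrableOn (fun t => ∑ i, ∑ j, v i * v j *
        confluentIntegrand (b + i + j) d x w t) (Ioi 0) :=
      integrable_finsetSum _ fun i _ => integrable_finsetSum _ fun j _ => hint i j
    have hsq : EqOn (fun t => ∑ i, ∑ j, v i * v j * confluentIntegrand (b + i + j) d x w t)
        (fun t => p.eval t ^ 2 * confluentIntegrand b d x w t) (Ioi 0) := by
      intro t ht
      simp only [hpe]
      rw [sq, Finset.sum_mul_sum, Finset.sum_mul]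
      refine Finset.sum_congr rfl fun i _ => ?_
      rw [Finset.sum_mul]
      refine Finset.sum_congr rfl fun j _ => ?_
      rw [hpow i j t ht]
      ring
    have heq : star v ⬝ᵥ (of fun i j : Fin N => confluentIntegral (b + i + j) d x w) *ᵥ v =
        ∫ t in Ioi (0 : ℝ), p.eval t ^ 2 * confluentIntegrand b d x w t := by
      rw [← setIntegral_congr_fun measurableSet_Ioi hsq,
        integral_finsetSum _ fun i _ => integrable_finsetSum _ fun j _ => hint i j]
      simp only [dotProduct, mulVec, star_trivial, of_apply]
      refine Finset.sum_congr rfl fun i _ => ?_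
      rw [integral_finsetSum _ fun j _ => hint i j, Finset.mul_sum]
      refine Finset.sum_congr rfl fun j _ => ?_
      rw [integral_const_mul, confluentIntegral]
      ring
    have hsum' := hsum.congr_fun hsq measurableSet_Ioi
    rw [heq, setIntegral_pos_iff_support_of_nonneg_ae _ hsum']
    · have hsub : Ioi (0 : ℝ) \ (p.roots.toFinset : Set ℝ) ⊆
          Function.support (fun t => p.eval t ^ 2 * confluentIntegrand b d x w t) ∩ Ioi 0 := by
        rintro t ⟨ht, ht'⟩
        refine ⟨mul_ne_zero (pow_ne_zero 2 fun h => ht' ?_) (confluentIntegrand_pos hw ht).ne', ht⟩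
        simp [hp0, h]
      refine lt_of_lt_of_le ?_ (measure_mono hsub)
      rw [measure_sdiff_null (p.roots.toFinset.finite_toSet.measure_zero _)]
      simp
    · refine (ae_restrict_mem measurableSet_Ioi).mono fun t ht => ?_
      exact mul_nonneg (sq_nonneg _) (confluentIntegrand_pos hw ht).le

theorem gamma_mul_tricomiV_sub {s : ℝ} (hs : ∀ k : ℕ, s + k ≠ 0) (d : ℝ) {x w : ℝ} (hx : 0 < x)
    (hw : 0 < w) (i : ℕ) :
    Real.Gamma s * tricomiV s (d - i) x w = ∑ k ∈ Finset.range (i + 1),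
      (i.choose k : ℝ) * w ^ (i - k) * (Real.Gamma (s + k) * tricomiV (s + k) d x w) := by
  induction i generalizing s d with
  | zero => simp
  | succ i ih =>
    have hs0 : s ≠ 0 := by simpa using hs 0
    have hs1 : ∀ k : ℕ, s + 1 + k ≠ 0 := fun k => by
      have := hs (k + 1)
      push_cast at this
      rwa [add_right_comm, add_assoc]
    have h1 := tricomiV_sub_one_right s (d - i) hx hw
    have h2 := ih hs d
    have h3 := ih hs1 d
    rw [Real.Gamma_add_one hs0] at h3
    have h4 : Real.Gamma s * tricomiV s (d - (i + 1 : ℕ)) x w =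
        w * (Real.Gamma s * tricomiV s (d - i) x w) +
        s * Real.Gamma s * tricomiV (s + 1) (d - i) x w := by
      rw [show d - ((i + 1 : ℕ) : ℝ) = d - i - 1 by push_cast; ring, h1]
      ring
    rw [h4, h2, h3, Finset.sum_range_succ' _ (i + 1), Finset.sum_range_succ' _ i,
      Finset.sum_range_succ _ i, Finset.sum_range_succ _ i, mul_add, Finset.mul_sum]
    have h5 : ∀ k ∈ Finset.range i, ((i + 1).choose (k + 1) : ℝ) * w ^ (i + 1 - (k + 1)) *
        (Real.Gamma (s + (k + 1 : ℕ)) * tricomiV (s + (k + 1 : ℕ)) d x w) =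
        w * ((i.choose (k + 1) : ℝ) * w ^ (i - (k + 1)) *
        (Real.Gamma (s + (k + 1 : ℕ)) * tricomiV (s + (k + 1 : ℕ)) d x w)) +
        (i.choose k : ℝ) * w ^ (i - k) *
        (Real.Gamma (s + 1 + k) * tricomiV (s + 1 + k) d x w) := by
      intro k hk
      have hk : k < i := Finset.mem_range.1 hk
      rw [Nat.choose_succ_succ, show i + 1 - (k + 1) = i - (k + 1) + 1 by omega,
        show i - k = i - (k + 1) + 1 by omega,
        show s + ((k + 1 : ℕ) : ℝ) = s + 1 + k by push_cast; ring, pow_succ]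
      push_cast
      ring
    rw [Finset.sum_congr rfl h5, Finset.sum_add_distrib]
    simp only [Nat.choose_self, Nat.choose_zero_right, Nat.sub_zero, Nat.sub_self]
    rw [show s + ((i + 1 : ℕ) : ℝ) = s + 1 + i by push_cast; ring]
    ring

theorem prod_gamma_mul_det {N : ℕ} {b : ℝ} (hb : ∀ (j : Fin N) (k : ℕ), b - j + k ≠ 0) (d : ℝ)
    {x w : ℝ} (hx : 0 < x) (hw : 0 < w) :
    (∏ j : Fin N, Real.Gamma (b - j)) *
      (of fun i j : Fin N => tricomiV (b - j) (d - i) x w).det =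
    (of fun i j : Fin N => Real.Gamma (b - j + i) * tricomiV (b - j + i) d x w).det := by
  rw [← det_mul_row]
  set L : Matrix (Fin N) (Fin N) ℝ := of fun i k => ((i : ℕ).choose k : ℝ) * w ^ ((i : ℕ) - k)
  have hL : L.det = 1 := by
    rw [det_of_isLowerTriangular]
    · simp [L]
    · intro i k hik
      have : (i : ℕ) < k := hik
      simp [L, Nat.choose_eq_zero_of_lt this]
  rw [← one_mul (det (of fun i j : Fin N => Real.Gamma (b - j + i) * tricomiV (b - j + i) d x w)),
    ← hL, ← det_mul]
  congr 1
  ext i j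
  simp only [of_apply, mul_apply, L]
  rw [gamma_mul_tricomiV_sub (hb j) d hx hw, Fin.sum_univ_eq_sum_range (fun k : ℕ =>
    ((i : ℕ).choose k : ℝ) * w ^ ((i : ℕ) - k) *
      (Real.Gamma (b - j + k) * tricomiV (b - j + k) d x w))]
  refine Finset.sum_subset (Finset.range_subset_range.2 (by omega)) fun k _ hk => ?_
  rw [Nat.choose_eq_zero_of_lt (by simpa using hk)]
  simp

/-- The determinant of signed contiguous translates of `tricomiV`, which is a Wronskian. -/
noncomputable def tricomiDet (N : ℕ) (b d x w : ℝ) : ℝ :=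
  (of fun i j : Fin N => (-1) ^ (i : ℕ) * tricomiV (b - j) (d - i) x w).det

theorem tricomiDet_eq (N : ℕ) (b d x w : ℝ) : tricomiDet N b d x w =
    (∏ j : Fin N, (-1) ^ (j : ℕ)) * (of fun i j : Fin N => tricomiV (b - j) (d - i) x w).det := by
  rw [tricomiDet, ← det_mul_column]
  rfl

theorem prod_neg_one_pow_sq (N : ℕ) :
    (∏ j : Fin N, (-1 : ℝ) ^ (j : ℕ)) * ∏ j : Fin N, (-1 : ℝ) ^ (j : ℕ) = 1 := by
  rw [← Finset.prod_mul_distrib]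
  exact Finset.prod_eq_one fun j _ => by rw [← mul_pow]; simp

theorem tricomiDet_pos_of_left {N : ℕ} {b : ℝ} (d : ℝ) {x w : ℝ} (hb : (N : ℝ) - 1 < b)
    (hx : 0 < x) (hw : 0 < w) : 0 < tricomiDet N b d x w := by
  have hpos : ∀ (j : Fin N) (k : ℕ), 0 < b - j + k := fun j k => by
    have h1 : ((j : ℕ) : ℝ) + 1 ≤ N := by exact_mod_cast j.2
    have h2 : (0 : ℝ) ≤ k := k.cast_nonneg
    linarith
  have hG : 0 < ∏ j : Fin N, Real.Gamma (b - j) :=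
    Finset.prod_pos fun j _ => Real.Gamma_pos_of_pos (by simpa using hpos j 0)
  have h1 := prod_gamma_mul_det (fun j k => (hpos j k).ne') d hx hw
  have h2 : (of fun i j : Fin N => Real.Gamma (b - j + i) * tricomiV (b - j + i) d x w) =
      (of fun i j : Fin N => confluentIntegral (b - N + 1 + i + j) d x w).submatrix
        id Fin.revPerm := by
    ext i j
    have h3 : b - N + 1 + i + ((Fin.rev j : ℕ) : ℝ) = b - j + i := by
      rw [Fin.val_rev, Nat.cast_sub (by omega)]
      push_cast
      ring
    simp only [of_apply, submatrix_apply, id, Fin.revPerm_apply, h3]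
    rw [tricomiV_of_pos (hpos j i), mul_inv_cancel_left₀ (Real.Gamma_pos_of_pos (hpos j i)).ne']
  rw [h2, det_permute', sign_revPerm] at h1
  push_cast at h1
  have h4 := det_confluentIntegral_pos (N := N) (b := b - N + 1) d (by linarith) hx hw
  have h5 : (∏ j : Fin N, Real.Gamma (b - j)) * tricomiDet N b d x w =
      (of fun i j : Fin N => confluentIntegral (b - N + 1 + i + j) d x w).det := by
    rw [tricomiDet_eq, mul_left_comm, h1, ← mul_assoc, prod_neg_one_pow_sq, one_mul]
  exact pos_of_mul_pos_right (h5 ▸ h4) hG.le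

theorem tricomiDet_pos_of_right {N : ℕ} (b : ℝ) {d x w : ℝ} (hd : (N : ℝ) - 1 < d)
    (hx : 0 < x) (hw : 0 < w) : 0 < tricomiDet N b d x w := by
  refine (tricomiDet_pos_of_left b hd hw hx).trans_eq ?_
  rw [tricomiDet_eq, tricomiDet_eq, ← det_transpose]
  congr 2
  ext i j
  have h1 : ((i : ℕ) : ℝ) + 1 ≤ N := by exact_mod_cast i.2
  exact (tricomiV_comm _ (by linarith) hx hw).symm

theorem tricomiDet_mul_tricomiDet {M : ℕ} {b : ℝ} (hb : ∀ k : ℤ, b ≠ k) {d x w : ℝ} (hx : 0 < x)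
    (hw : 0 < w) (h : tricomiDet M b d x w ≠ 0) :
    tricomiDet (M + 2) b d x w * tricomiDet M b d x w =
      b * (tricomiDet (M + 1) (b - 1) d x w * tricomiDet (M + 1) (b + 1) d x w) -
      (b - (M + 1)) * tricomiDet (M + 1) b d x w ^ 2 := by
  have hG : ∀ k : ℤ, Real.Gamma (b + k) ≠ 0 := fun k => Real.Gamma_ne_zero fun m hm =>
    hb (-m - k) (by push_cast; linarith)
  have hne : ∀ (l : ℤ) (N : ℕ) (j : Fin N) (k : ℕ), b + l - j + k ≠ 0 := fun l N j k hk =>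
    hb (j - k - l) (by push_cast; linarith)
  have hT : ∀ (l : ℤ) (N : ℕ), (∏ j : Fin N, Real.Gamma (b + l - j)) *
      (of fun i j : Fin N => tricomiV (b + l - j) (d - i) x w).det =
      (of fun i j : Fin N => (fun k : ℤ => Real.Gamma (b + k) * tricomiV (b + k) d x w)
        (l + i - j)).det := by
    intro l N
    rw [prod_gamma_mul_det (hne l N) d hx hw]
    congr 1
    ext i j
    simp only [of_apply]
    rw [show b + ((l + i - j : ℤ) : ℝ) = b + l - j + i by push_cast; ring]
  have t0 := fun N => hT 0 N
  have t1 := hT 1 (M + 1)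
  have t2 := hT (-1) (M + 1)
  simp only [Int.cast_zero, add_zero, zero_add] at t0
  simp only [Int.cast_one, Int.cast_neg] at t1 t2
  rw [← sub_eq_add_neg] at t2
  have g1 : ∏ j : Fin (M + 2), Real.Gamma (b - j) =
      (∏ j : Fin (M + 1), Real.Gamma (b - j)) * Real.Gamma (b - (M + 1)) := by
    rw [Fin.prod_univ_castSucc]; simp
  have g2 : ∏ j : Fin (M + 1), Real.Gamma (b - j) =
      (∏ j : Fin M, Real.Gamma (b - j)) * Real.Gamma (b - M) := by
    rw [Fin.prod_univ_castSucc]; simp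
  have g3 : ∏ j : Fin (M + 1), Real.Gamma (b + 1 - j) =
      Real.Gamma (b + 1) * ∏ j : Fin M, Real.Gamma (b - j) := by
    rw [Fin.prod_univ_succ]; simp
  have g4 : ∏ j : Fin (M + 2), Real.Gamma (b - j) =
      Real.Gamma b * ∏ j : Fin (M + 1), Real.Gamma (b - 1 - j) := by
    rw [Fin.prod_univ_succ]; simp [sub_sub, add_comm]
  have g5 : Real.Gamma (b - M) = (b - (M + 1)) * Real.Gamma (b - (M + 1)) := by
    rw [← Real.Gamma_add_one (sub_ne_zero.2 (by exact_mod_cast hb (M + 1)))]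
    congr 1
    ring
  have g6 : Real.Gamma (b + 1) = b * Real.Gamma b :=
    Real.Gamma_add_one (by exact_mod_cast hb 0)
  have g7 : ∀ N : ℕ, ∏ j : Fin N, Real.Gamma (b - j) ≠ 0 := fun N =>
    Finset.prod_ne_zero_iff.2 fun j _ => by simpa [sub_eq_add_neg] using hG (-j)
  have s1 : (∏ j : Fin (M + 2), (-1 : ℝ) ^ (j : ℕ)) =
      (∏ j : Fin (M + 1), (-1 : ℝ) ^ (j : ℕ)) * (-1) ^ (M + 1) := by
    rw [Fin.prod_univ_castSucc]; simp
  have s2 : (∏ j : Fin (M + 1), (-1 : ℝ) ^ (j : ℕ)) =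
      (∏ j : Fin M, (-1 : ℝ) ^ (j : ℕ)) * (-1) ^ M := by
    rw [Fin.prod_univ_castSucc]; simp
  have hM : (of fun i j : Fin M => tricomiV (b - j) (d - i) x w).det ≠ 0 := by
    rw [tricomiDet_eq] at h
    exact right_ne_zero_of_mul h
  have key := det_toeplitz_mul_det (M := M)
    (fun k : ℤ => Real.Gamma (b + k) * tricomiV (b + k) d x w)
    (by rw [← t0]; exact mul_ne_zero (g7 M) hM)
  rw [← t0, ← t0, ← t0, ← t1, ← t2] at key
  simp only [tricomiDet_eq]
  rw [s1, s2, pow_succ]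
  rw [g3, g6] at key
  have g9 : (∏ j : Fin (M + 1), Real.Gamma (b - j)) ^ 2 = (b - (M + 1)) *
      ((∏ j : Fin (M + 2), Real.Gamma (b - j)) * ∏ j : Fin M, Real.Gamma (b - j)) := by
    rw [g1, g2, g5]; ring
  set P2 := ∏ j : Fin (M + 2), Real.Gamma (b - j)
  set P1 := ∏ j : Fin (M + 1), Real.Gamma (b - j)
  set P0 := ∏ j : Fin M, Real.Gamma (b - j)
  set Q := ∏ j : Fin (M + 1), Real.Gamma (b - 1 - j)
  set D2 := (of fun i j : Fin (M + 2) => tricomiV (b - j) (d - i) x w).det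
  set D1 := (of fun i j : Fin (M + 1) => tricomiV (b - j) (d - i) x w).det
  set D0 := (of fun i j : Fin M => tricomiV (b - j) (d - i) x w).det
  set Dm := (of fun i j : Fin (M + 1) => tricomiV (b - 1 - j) (d - i) x w).det
  set Dp := (of fun i j : Fin (M + 1) => tricomiV (b + 1 - j) (d - i) x w).det
  have hD : D2 * D0 = (b - (M + 1)) * D1 ^ 2 - b * (Dm * Dp) := by
    refine mul_left_cancel₀ (mul_ne_zero (g7 (M + 2)) (g7 M)) ?_
    change P2 * P0 * (D2 * D0) = P2 * P0 * _
    linear_combination key + D1 ^ 2 * g9 + P0 * b * Dm * Dp * g4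
  set e := (-1 : ℝ) ^ M
  set s := ∏ j : Fin M, (-1 : ℝ) ^ (j : ℕ)
  linear_combination (-(s * s) * (e * e)) * hD

theorem tricomiDet_pos {N : ℕ} {b d x w : ℝ} (hb : ∀ k : ℤ, b ≠ k) (hx : 0 < x) (hw : 0 < w)
    (h : (N : ℝ) - 1 < b ∨ (N : ℝ) - 1 < d ∨
      ∃ q : ℕ, q + 2 ≤ N ∧ (q : ℝ) < d ∧ (N : ℝ) - 2 - q < b) :
    0 < tricomiDet N b d x w := by
  induction N using Nat.strong_induction_on generalizing b with
  | _ N ih =>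
  by_cases hA : (N : ℝ) - 1 < b
  · exact tricomiDet_pos_of_left d hA hx hw
  by_cases hB : (N : ℝ) - 1 < d
  · exact tricomiDet_pos_of_right b hB hx hw
  obtain ⟨q, hqN, hqd, hqb⟩ := (h.resolve_left hA).resolve_left hB
  obtain ⟨M, rfl⟩ : ∃ M, N = M + 2 := ⟨N - 2, by omega⟩
  have hqM : q ≤ M := by omega
  have hqM' : (q : ℝ) ≤ M := by exact_mod_cast hqM
  push_cast at hA hB hqb
  have hcond : ∀ c : ℝ, b - 1 ≤ c → ((M + 1 : ℕ) : ℝ) - 1 < c ∨ ((M + 1 : ℕ) : ℝ) - 1 < d ∨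
      ∃ q : ℕ, q + 2 ≤ M + 1 ∧ (q : ℝ) < d ∧ ((M + 1 : ℕ) : ℝ) - 2 - q < c := by
    intro c hc
    push_cast
    rcases hqM.eq_or_lt with rfl | hlt
    · exact Or.inr (Or.inl (by linarith))
    · exact Or.inr (Or.inr ⟨q, by omega, hqd, by linarith⟩)
  have h0 : 0 < tricomiDet M b d x w := by
    refine ih M (by omega) hb (Or.inr ?_)
    by_cases hq : q + 2 ≤ M
    · exact Or.inr ⟨q, hq, hqd, by linarith⟩
    · have : (M : ℝ) ≤ q + 1 := by exact_mod_cast (by omega : M ≤ q + 1)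
      exact Or.inl (by linarith)
  have hm : 0 < tricomiDet (M + 1) (b - 1) d x w :=
    ih (M + 1) (by omega) (fun k hk => hb (k + 1) (by push_cast; linarith)) (hcond _ le_rfl)
  have hp : 0 < tricomiDet (M + 1) (b + 1) d x w :=
    ih (M + 1) (by omega) (fun k hk => hb (k - 1) (by push_cast; linarith))
      (hcond _ (by linarith))
  have hrec := tricomiDet_mul_tricomiDet hb hx hw h0.ne'
  refine pos_of_mul_pos_left (hrec ▸ ?_) h0.le
  have hb0 : 0 < b := by linarith
  have := mul_pos hb0 (mul_pos hm hp)
  nlinarith [sq_nonneg (tricomiDet (M + 1) b d x w)]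

theorem det_tricomiV_pos {m : ℕ} {b d : ℝ}
    (h : ∀ k ≤ m, ∀ x w, 0 < x → 0 < w → 0 < tricomiDet k b d x w)
    {x w : Fin m → ℝ} (hx : StrictMono x) (hw : StrictAnti w) (hx0 : ∀ i, 0 < x i)
    (hw0 : ∀ i, 0 < w i) :
    0 < (of fun i j => tricomiV b d (x i) (w j)).det := by
  set r : ℕ → ℝ := fun j => if h : j < m then w ⟨j, h⟩ else 1 with hr
  have hr0 : ∀ j, 0 < r j := fun j => by
    simp only [hr]; split_ifs
    exacts [hw0 _, one_pos]
  have hrw : ∀ {k} (hk : k ≤ m) (j : Fin k), r j = w (j.castLE hk) := fun hk j => by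
    simp only [hr, dif_pos (j.2.trans_le hk)]; rfl
  have hstep : ∀ k ≤ m, ∀ t ∈ Ioi (0 : ℝ),
      0 < (of fun i j : Fin k => (-1) ^ (i : ℕ) * tricomiV b (d - i) t (r j)).det := by
    intro k hk t ht
    have h1 := det_pos_of_wronskian_pos (S := Iio 0) ordConnected_Iio (N := k)
      (F := fun j i s => (-1) ^ i * tricomiV (b - j) (d - i) t (-s)) ?_ ?_
      (x := fun j => -r j) ?_ ?_
    · rw [← det_transpose]
      refine h1.trans_eq (congrArg det ?_)
      ext j i
      simp
    · intro j i s hs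
      have hs : s < 0 := hs
      have h2 := (hasDerivAt_tricomiV_right (b - j) (d - i) ht (neg_pos.2 hs)).comp s
        (hasDerivAt_neg s)
      refine (h2.const_mul ((-1) ^ i)).congr_deriv ?_
      rw [show b - ((j + 1 : ℕ) : ℝ) = b - j - 1 by push_cast; ring]
      ring
    · intro l hl s hs
      have hs : s < 0 := hs
      refine (h l (hl.trans hk) t (-s) ht (neg_pos.2 hs)).trans_eq ?_
      rw [tricomiDet, ← det_transpose]
      rfl
    · intro i j hij
      simp only [hrw hk, neg_lt_neg_iff]
      exact hw hij
    · exact fun j => neg_lt_zero.2 (hr0 j)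
  have h1 := det_pos_of_wronskian_pos (S := Ioi 0) ordConnected_Ioi (N := m)
    (F := fun i j t => (-1) ^ i * tricomiV b (d - i) t (r j)) ?_ hstep hx hx0
  · refine h1.trans_eq (congrArg det ?_)
    ext i j
    simp [hrw le_rfl]
  · intro i j t ht
    refine ((hasDerivAt_tricomiV b (d - i) ht (hr0 j)).const_mul ((-1) ^ i)).congr_deriv ?_
    rw [show d - ((i + 1 : ℕ) : ℝ) = d - i - 1 by push_cast; ring]
    ring

theorem kernelT_eq_mul_tricomiV {b d x y : ℝ} (hb : 0 < b) (hy : 0 < y) :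
    kernelT b d x y = y⁻¹ ^ (d - b) * tricomiV b d x y⁻¹ := by
  have h1 : confluentIntegral b d (x * y⁻¹) 1 = Real.exp (-(x / y)) *
      ∫ t in Ioi (0 : ℝ), Real.exp (-t * (x / y)) * t ^ (b - 1) * (1 + t) ^ (-d) := by
    rw [confluentIntegral, ← integral_const_mul]
    congr 1
    funext t
    rw [confluentIntegrand, show -(x * y⁻¹ * (1 + t)) = -(x / y) + -t * (x / y) by ring,
      Real.exp_add]
    ring
  have h2 : y⁻¹ ^ (d - b) * y⁻¹ ^ (b - d) = 1 := by
    rw [← Real.rpow_add (inv_pos.2 hy)]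
    simp
  rw [tricomiV_of_pos hb, confluentIntegral_eq_rpow_mul (inv_pos.2 hy), h1, kernelT, tricomiF]
  linear_combination (-Real.exp (-(x / y)) * ((Real.Gamma b)⁻¹ *
    ∫ t in Ioi (0 : ℝ), Real.exp (-t * (x / y)) * t ^ (b - 1) * (1 + t) ^ (-d))) * h2

end

/-- If `(d,b)` lies above the staircase `E_n`, then `T_{b,d}` is totally positive
of order `n+1`. -/
theorem kernelT_TP_above_staircase (n : ℕ) (hn : 1 ≤ n) (b d : ℝ) (hb : 0 < b)
    (hbnat : ¬ ∃ k : ℕ, b = k + 1) (hdnat : ¬ ∃ k : ℕ, d = k)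
    (habove : ∀ k : ℕ, k < n → ((k : ℝ) ≤ d ∨ (n : ℝ) - k ≤ b))
    (m : ℕ) (hm1 : 1 ≤ m) (hm2 : m ≤ n + 1)
    (x y : Fin m → ℝ) (hx : StrictMono x) (hy : StrictMono y)
    (hxpos : ∀ i, 0 < x i) (hypos : ∀ i, 0 < y i) :
    0 ≤ Matrix.det (Matrix.of fun i j => kernelT b d (x i) (y j)) := by
  have hbint : ∀ k : ℤ, b ≠ k := by
    rintro k rfl
    have hk : 0 < k := by exact_mod_cast hb
    refine hbnat ⟨(k - 1).toNat, ?_⟩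
    exact_mod_cast (by omega : k = (k - 1).toNat + 1)
  have hdet : ∀ k ≤ m, ∀ u w, 0 < u → 0 < w → 0 < tricomiDet k b d u w := by
    intro k hk u w hu hw
    refine tricomiDet_pos hbint hu hw ?_
    have hkn : (k : ℝ) ≤ n + 1 := by exact_mod_cast hk.trans hm2
    rcases lt_or_ge d 0 with hd | hd
    · have h0 := (habove 0 hn).resolve_left (by simpa using hd)
      have hne := hbint n
      push_cast at h0 hne
      rw [sub_zero] at h0
      have := lt_of_le_of_ne h0 hne.symm
      exact Or.inl (by linarith)
    · have hq1 : (⌊d⌋₊ : ℝ) < d := lt_of_le_of_ne (Nat.floor_le hd) fun h => hdnat ⟨_, h.symm⟩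
      have hq2 := Nat.lt_floor_add_one d
      set q := ⌊d⌋₊
      by_cases hkq : k ≤ q + 1
      · have : (k : ℝ) ≤ q + 1 := by exact_mod_cast hkq
        exact Or.inr (Or.inl (by linarith))
      · refine Or.inr (Or.inr ⟨q, by omega, hq1, ?_⟩)
        by_cases hqn : q + 1 < n
        · have h0 := (habove (q + 1) hqn).resolve_left (by push_cast; linarith)
          have hne := hbint (n - (q + 1 : ℕ))
          push_cast at h0 hne
          have := lt_of_le_of_ne h0 hne.symm
          linarith
        · have : (k : ℝ) ≤ q + 2 := by exact_mod_cast (by omega : k ≤ q + 2)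
          linarith
  have hpos := det_tricomiV_pos hdet (w := fun j => (y j)⁻¹) hx
    (fun i j hij => inv_strictAnti₀ (hypos i) (hy hij)) hxpos fun j => inv_pos.2 (hypos j)
  have hker : (Matrix.of fun i j => kernelT b d (x i) (y j)) = Matrix.of fun i j =>
      (y j)⁻¹ ^ (d - b) *
        Matrix.of (fun i j => tricomiV b d (x i) (y j)⁻¹) i j := by
    ext i j
    exact kernelT_eq_mul_tricomiV hb (hypos j)
  rw [hker, Matrix.det_mul_row (fun j => (y j)⁻¹ ^ (d - b))]
  exact mul_nonneg (Finset.prod_nonneg fun j _ => (Real.rpow_pos_of_pos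
    (inv_pos.2 (hypos j)) _).le) hpos.le
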